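/- Let Σ_Λ be a subshift of finite type, let φ : Σ_Λ → ℝ satisfy φ(x) = φ(y) whenever x_j = y_j for all j ≥ 0 and var_k φ ≤ b α^k for all k ≥ 0 (some b > 0, α ∈ (0,1)), and let μ be a Gibbs measure for φ with constants c_1, c_2, p. Then for every involution σ ∈ H there exist constants 0 < α' ≤ β' < ∞ such that α'·μ(E) ≤ μ(T_σ^{-1}E) ≤ β'·μ(E) for every measurable set E ⊆ Γ_σ = Σ_Λ ∩ T_σ^{-1}Σ_Λ. -/

import Mathlib

open MeasureTheory Filter Topology ENNReal

/-- The left shift on `K^ℤ`: `(S ω) n = ω (n+1)`. -/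
def shiftMap (K : Type*) : (ℤ → K) → (ℤ → K) := fun ω n => ω (n + 1)

/-- For `τ : ℤ → ℤ`, the map `T_τ : K^ℤ → K^ℤ`, `(T_τ ω) n = ω (τ n)`. -/
def Tmap {K : Type*} (τ : ℤ → ℤ) (ω : ℤ → K) : ℤ → K := fun n => ω (τ n)

/-- A permutation of `ℤ` has finite support if it fixes all `n` with `|n| ≥ N` for some `N`. -/
def FinitelySupported (σ : Equiv.Perm ℤ) : Prop :=
  ∃ N : ℕ, ∀ n : ℤ, (N : ℤ) ≤ |n| → σ n = n

/-- The subshift of finite type `Σ_Λ = {x ∈ K^ℤ : Λ_{x_i, x_{i+1}} = 1 ∀ i}`, `K = Fin N`. -/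
def SigmaSFT {N : ℕ} (Λ : Fin N → Fin N → Bool) : Set (ℤ → Fin N) :=
  {x | ∀ i : ℤ, Λ (x i) (x (i + 1)) = true}

/-- The cylinder `{y ∈ Σ_Λ : y_j = x_j, j = 0, ..., m}`. -/
def cylSFT {N : ℕ} (Λ : Fin N → Fin N → Bool) (x : ℤ → Fin N) (m : ℕ) : Set (ℤ → Fin N) :=
  {y ∈ SigmaSFT Λ | ∀ j : ℕ, j ≤ m → y (j : ℤ) = x (j : ℤ)}

/-- `μ` is a Gibbs measure for `φ` with constants `c₁, c₂, p`: a shift-invariant probability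
measure on `Σ_Λ` with `c₁ ≤ μ[x_0 ... x_m] / exp(-pm + ∑_{j<m} φ(S^j x)) ≤ c₂`. -/
def IsGibbs {N : ℕ} (Λ : Fin N → Fin N → Bool) (φ : (ℤ → Fin N) → ℝ)
    (μ : Measure (ℤ → Fin N)) (c₁ c₂ p : ℝ) : Prop :=
  IsProbabilityMeasure μ ∧ μ (SigmaSFT Λ) = 1 ∧ μ.map (shiftMap (Fin N)) = μ ∧
  0 < c₁ ∧ 0 < c₂ ∧
  ∀ x ∈ SigmaSFT Λ, ∀ m : ℕ,
    c₁ * Real.exp (-(p * m) + ∑ j ∈ Finset.range m, φ (fun i => x (i + j))) ≤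
        (μ (cylSFT Λ x m)).toReal ∧
      (μ (cylSFT Λ x m)).toReal ≤
        c₂ * Real.exp (-(p * m) + ∑ j ∈ Finset.range m, φ (fun i => x (i + j)))

/-- The two-sided cylinder `{y : y_j = x_j for |j| ≤ n}`. -/
def windowCyl {K : Type*} (x : ℤ → K) (n : ℕ) : Set (ℤ → K) :=
  {y | ∀ j : ℤ, |j| ≤ (n : ℤ) → y j = x j}

section Tmap

variable {K : Type*} {σ : Equiv.Perm ℤ}

theorem Tmap_Tmap (hσ : ∀ n, σ (σ n) = n) (x : ℤ → K) : Tmap ⇑σ (Tmap ⇑σ x) = x := by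
  funext n
  simp [Tmap, hσ]

theorem Tmap_apply_of_le_abs {M : ℕ} (hM : ∀ n : ℤ, (M : ℤ) ≤ |n| → σ n = n) (x : ℤ → K)
    {n : ℤ} (hn : (M : ℤ) ≤ |n|) : Tmap ⇑σ x n = x n := by
  simp [Tmap, hM n hn]

theorem abs_apply_le_of_abs_le {M n : ℕ} (hM : ∀ n : ℤ, (M : ℤ) ≤ |n| → σ n = n)
    (hn : M ≤ n) {j : ℤ} (hj : |j| ≤ (n : ℤ)) : |σ j| ≤ (n : ℤ) := by
  by_contra! h
  have h1 : σ (σ j) = σ j := hM _ (by omega)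
  have h2 : σ j = j := σ.injective h1
  rw [h2] at h
  omega

theorem mem_windowCyl_of_Tmap {M n : ℕ} (hM : ∀ n : ℤ, (M : ℤ) ≤ |n| → σ n = n)
    (hσ : ∀ n, σ (σ n) = n) (hn : M ≤ n) {x y w : ℤ → K} (hx : Tmap ⇑σ x ∈ windowCyl w n)
    (hy : Tmap ⇑σ y ∈ windowCyl w n) : y ∈ windowCyl x n := by
  intro j hj
  have hj' := abs_apply_le_of_abs_le hM hn hj
  have h := (hy _ hj').trans (hx _ hj').symm
  simpa [Tmap, hσ] using h

theorem measurable_Tmap [MeasurableSpace K] (τ : ℤ → ℤ) : Measurable (Tmap (K := K) τ) :=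
  measurable_pi_lambda _ fun n => measurable_pi_apply (τ n)

theorem measurable_shiftMap [MeasurableSpace K] : Measurable (shiftMap K) :=
  measurable_pi_lambda _ fun n => measurable_pi_apply (n + 1)

theorem shiftMap_iterate (n : ℕ) (x : ℤ → K) (i : ℤ) : (shiftMap K)^[n] x i = x (i + n) := by
  induction n generalizing x with
  | zero => simp
  | succ n ih =>
    rw [Function.iterate_succ_apply, ih]
    simp only [shiftMap]
    push_cast
    congr 1
    ring

end Tmap

section Subshift

variable {N : ℕ} {Λ : Fin N → Fin N → Bool}

theorem measurableSet_windowCyl (x : ℤ → Fin N) (n : ℕ) : MeasurableSet (windowCyl x n) := by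
  have : windowCyl x n = ⋂ j : ℤ, ⋂ _ : |j| ≤ (n : ℤ), (fun y : ℤ → Fin N => y j) ⁻¹' {x j} := by
    ext y
    simp [windowCyl]
  rw [this]
  exact MeasurableSet.iInter fun j => MeasurableSet.iInter fun _ =>
    measurable_pi_apply j (measurableSet_singleton _)

theorem measurableSet_SigmaSFT (Λ : Fin N → Fin N → Bool) : MeasurableSet (SigmaSFT Λ) := by
  have : SigmaSFT Λ = ⋂ i : ℤ, (fun y : ℤ → Fin N => (y i, y (i + 1))) ⁻¹'
      {q | Λ q.1 q.2 = true} := by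
    ext y
    simp [SigmaSFT]
  rw [this]
  exact MeasurableSet.iInter fun i =>
    ((measurable_pi_apply i).prodMk (measurable_pi_apply (i + 1))) (Set.toFinite _).measurableSet

theorem translate_mem_SigmaSFT {x : ℤ → Fin N} (hx : x ∈ SigmaSFT Λ) (k : ℤ) :
    (fun i => x (i + k)) ∈ SigmaSFT Λ := by
  intro i
  have := hx (i + k)
  rwa [add_right_comm] at this

/-- A shift-invariant measure gives two-sided cylinders the mass of one-sided ones. -/
theorem measure_windowCyl_inter_SigmaSFT {μ : Measure (ℤ → Fin N)}
    (hμ : μ.map (shiftMap (Fin N)) = μ) (x : ℤ → Fin N) (n : ℕ) :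
    μ (windowCyl x n ∩ SigmaSFT Λ) = μ (cylSFT Λ (fun i => x (i + -(n : ℤ))) (2 * n)) := by
  have hmp : MeasurePreserving (shiftMap (Fin N)) μ μ := ⟨measurable_shiftMap, hμ⟩
  rw [← (hmp.iterate n).measure_preimage
    ((measurableSet_windowCyl x n).inter (measurableSet_SigmaSFT Λ)).nullMeasurableSet]
  congr 1
  ext y
  have hfun : (shiftMap (Fin N))^[n] y = fun i => y (i + n) := funext (shiftMap_iterate n y)
  rw [Set.mem_preimage, hfun]
  constructor
  · rintro ⟨h1, h2⟩
    refine ⟨by simpa using translate_mem_SigmaSFT h2 (-(n : ℤ)), fun j hj => ?_⟩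
    have := h1 ((j : ℤ) + -(n : ℤ)) (abs_le.2 ⟨by omega, by omega⟩)
    simpa using this
  · rintro ⟨h1, h2⟩
    refine ⟨fun j hj => ?_, translate_mem_SigmaSFT h1 n⟩
    obtain ⟨hj1, hj2⟩ := abs_le.1 hj
    have h := h2 (j + n).toNat (by omega)
    rw [Int.toNat_of_nonneg (by omega)] at h
    simpa using h

/-- A finite measure dominating another one on all large two-sided cylinders dominates it. -/
theorem measure_le_of_windowCyl_le {ν μ : Measure (ℤ → Fin N)} [IsFiniteMeasure μ] (M : ℕ)
    (h : ∀ k x, ν (windowCyl x (M + k)) ≤ μ (windowCyl x (M + k))) : ν ≤ μ := by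
  have hcyl : ∀ k (s : Set (ℤ → Fin N)), (∀ x ∈ s, windowCyl x (M + k) ⊆ s) → ν s ≤ μ s := by
    intro k s hs
    set I : Finset ℤ := Finset.Icc (-((M + k : ℕ) : ℤ)) ((M + k : ℕ) : ℤ)
    set R : (ℤ → Fin N) → (I → Fin N) := I.restrict
    have hfib : ∀ x : ℤ → Fin N, R ⁻¹' {R x} = windowCyl x (M + k) := by
      intro x
      ext y
      simp [R, funext_iff, windowCyl, I, abs_le]
    have hpre : s = R ⁻¹' (R '' s).toFinite.toFinset := by
      ext y
      rw [Set.Finite.coe_toFinset]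
      refine ⟨fun hy => ⟨y, hy, rfl⟩, ?_⟩
      rintro ⟨x, hx, hxy⟩
      apply hs x hx
      rw [← hfib]
      exact hxy.symm
    have hmeas : ∀ v : I → Fin N, MeasurableSet (R ⁻¹' {v}) :=
      fun v => I.measurable_restrict (measurableSet_singleton v)
    rw [hpre, ← sum_measure_preimage_singleton _ fun v _ => hmeas v,
      ← sum_measure_preimage_singleton _ fun v _ => hmeas v]
    refine Finset.sum_le_sum fun v hv => ?_
    obtain ⟨x, -, rfl⟩ := (Set.Finite.mem_toFinset _).1 hv
    rw [hfib]
    exact h k x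
  have hopen : ∀ U : Set (ℤ → Fin N), IsOpen U → ν U ≤ μ U := by
    intro U hU
    set V : ℕ → Set (ℤ → Fin N) := fun k => {x | windowCyl x (M + k) ⊆ U}
    have hself : ∀ (x : ℤ → Fin N) n, x ∈ windowCyl x n := fun x n j _ => rfl
    have hVU : ⋃ k, V k = U := by
      refine Set.Subset.antisymm (Set.iUnion_subset fun k x hx => hx (hself x _)) fun x hx => ?_
      obtain ⟨I, u, hu, hIU⟩ := isOpen_pi_iff.1 hU x hx
      refine Set.mem_iUnion.2 ⟨I.sup Int.natAbs, fun y hy => hIU fun i hi => ?_⟩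
      have hi' : i.natAbs ≤ I.sup Int.natAbs := Finset.le_sup (f := Int.natAbs) hi
      rw [hy i (by rw [Int.abs_eq_natAbs]; exact_mod_cast hi'.trans (Nat.le_add_left _ M))]
      exact (hu i hi).2
    have hmono : Monotone V := fun k l hkl x hx y hy =>
      hx fun j hj => hy j (hj.trans (by push_cast; omega))
    have hV : ∀ k, ν (V k) ≤ μ (V k) := fun k => hcyl k _ fun x hx y hy z hz =>
      hx fun j hj => (hz j hj).trans (hy j hj)
    rw [← hVU, hmono.measure_iUnion, hmono.measure_iUnion]
    exact iSup_mono hV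
  refine Measure.le_iff'.2 fun s => ?_
  rw [s.measure_eq_iInf_isOpen μ]
  exact le_iInf₂ fun U hU => le_iInf fun hUo => (measure_mono hU).trans (hopen U hUo)

/-- A function on the subshift whose value varies boundedly once the zeroth symbol is fixed is
bounded. -/
theorem exists_bound_of_var_zero (hsymb : ∀ j : Fin N, ∃ x ∈ SigmaSFT Λ, x 0 = j)
    {φ : (ℤ → Fin N) → ℝ} {b : ℝ}
    (hvar : ∀ x ∈ SigmaSFT Λ, ∀ y ∈ SigmaSFT Λ, x 0 = y 0 → |φ x - φ y| ≤ b) :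
    ∃ B : ℝ, ∀ x ∈ SigmaSFT Λ, |φ x| ≤ B := by
  choose r hr hr0 using hsymb
  refine ⟨b + ∑ j, |φ (r j)|, fun x hx => ?_⟩
  have h1 := hvar x hx (r (x 0)) (hr _) (hr0 _).symm
  have h2 : |φ (r (x 0))| ≤ ∑ j, |φ (r j)| :=
    Finset.single_le_sum (f := fun j => |φ (r j)|) (fun j _ => abs_nonneg _) (Finset.mem_univ _)
  have h3 := abs_sub_abs_le_abs_sub (φ x) (φ (r (x 0)))
  linarith

/-- Birkhoff sums along two points that differ only at coordinates of modulus less than `M` are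
uniformly close. -/
theorem exists_birkhoff_sum_bound (hsymb : ∀ j : Fin N, ∃ x ∈ SigmaSFT Λ, x 0 = j)
    {φ : (ℤ → Fin N) → ℝ}
    (hdep : ∀ x ∈ SigmaSFT Λ, ∀ y ∈ SigmaSFT Λ,
      (∀ j : ℤ, 0 ≤ j → x j = y j) → φ x = φ y)
    {b α : ℝ} (hb : 0 < b) (hα : α ∈ Set.Ioo (0 : ℝ) 1)
    (hvar : ∀ k : ℕ, ∀ x ∈ SigmaSFT Λ, ∀ y ∈ SigmaSFT Λ,
      (∀ j : ℤ, |j| ≤ (k : ℤ) → x j = y j) → |φ x - φ y| ≤ b * α ^ k) (M : ℕ) :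
    ∃ D : ℝ, ∀ k : ℕ, ∀ x ∈ SigmaSFT Λ, ∀ y ∈ SigmaSFT Λ,
      (∀ j : ℤ, (M : ℤ) ≤ |j| → x j = y j) →
      ∑ j ∈ Finset.range (2 * (M + k)), φ (fun i => x (i + j + -((M + k : ℕ) : ℤ))) ≤
        ∑ j ∈ Finset.range (2 * (M + k)), φ (fun i => y (i + j + -((M + k : ℕ) : ℤ))) + D := by
  obtain ⟨B, hB⟩ := exists_bound_of_var_zero (φ := φ) (b := b) hsymb fun x hx y hy h =>
    (hvar 0 x hx y hy fun j hj => by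
      have : j = 0 := by simpa using hj
      rw [this, h]).trans (by simp)
  refine ⟨b * (1 - α)⁻¹ + (2 * M : ℕ) * (2 * B), fun k x hx y hy hxy => ?_⟩
  rw [← sub_le_iff_le_add', ← Finset.sum_sub_distrib,
    show 2 * (M + k) = k + 2 * M + k by ring, Finset.sum_range_add, Finset.sum_range_add]
  have hmem : ∀ z ∈ SigmaSFT Λ, ∀ j : ℕ,
      (fun i : ℤ => z (i + j + -((M + k : ℕ) : ℤ))) ∈ SigmaSFT Λ := fun z hz j => by
    simpa only [add_assoc] using translate_mem_SigmaSFT hz ((j : ℤ) + -((M + k : ℕ) : ℤ))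
  have hleft : ∑ j ∈ Finset.range k, (φ (fun i => x (i + j + -((M + k : ℕ) : ℤ))) -
      φ (fun i => y (i + j + -((M + k : ℕ) : ℤ)))) ≤ b * (1 - α)⁻¹ := by
    calc _ ≤ ∑ j ∈ Finset.range k, b * α ^ (k - 1 - j) := by
          refine Finset.sum_le_sum fun j hj => (le_abs_self _).trans ?_
          have hj' := Finset.mem_range.1 hj
          refine hvar _ _ (hmem x hx j) _ (hmem y hy j) fun i hi => hxy _ ?_
          rw [abs_le] at hi
          rw [le_abs]
          right
          push_cast
          omega
      _ = b * ∑ j ∈ Finset.range k, α ^ j := by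
          rw [← Finset.mul_sum, Finset.sum_range_reflect fun j => α ^ j]
      _ ≤ b * (1 - α)⁻¹ := by
          rw [← tsum_geometric_of_lt_one hα.1.le hα.2]
          exact mul_le_mul_of_nonneg_left ((summable_geometric_of_lt_one hα.1.le hα.2).sum_le_tsum _
            fun j _ => pow_nonneg hα.1.le j) hb.le
  have hmid : ∑ j ∈ Finset.range (2 * M),
      (φ (fun i => x (i + (k + j : ℕ) + -((M + k : ℕ) : ℤ))) -
        φ (fun i => y (i + (k + j : ℕ) + -((M + k : ℕ) : ℤ)))) ≤ (2 * M : ℕ) * (2 * B) := by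
    refine (Finset.sum_le_card_nsmul _ _ (2 * B) fun j _ => ?_).trans (by simp)
    have h1 := abs_le.1 (hB _ (hmem x hx (k + j)))
    have h2 := abs_le.1 (hB _ (hmem y hy (k + j)))
    linarith [h1.2, h2.1]
  have hright : ∑ j ∈ Finset.range k,
      (φ (fun i => x (i + (k + 2 * M + j : ℕ) + -((M + k : ℕ) : ℤ))) -
        φ (fun i => y (i + (k + 2 * M + j : ℕ) + -((M + k : ℕ) : ℤ)))) = 0 := by
    refine Finset.sum_eq_zero fun j _ => sub_eq_zero.2 ?_
    refine hdep _ (hmem x hx _) _ (hmem y hy _) fun i hi => hxy _ ?_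
    rw [le_abs]
    left
    push_cast
    omega
  linarith

/-- A Gibbs measure gives comparable mass to the two-sided cylinders around two points that differ
only at coordinates of modulus less than `M`. -/
theorem exists_windowCyl_comparison (hsymb : ∀ j : Fin N, ∃ x ∈ SigmaSFT Λ, x 0 = j)
    {φ : (ℤ → Fin N) → ℝ}
    (hdep : ∀ x ∈ SigmaSFT Λ, ∀ y ∈ SigmaSFT Λ,
      (∀ j : ℤ, 0 ≤ j → x j = y j) → φ x = φ y)
    {b α : ℝ} (hb : 0 < b) (hα : α ∈ Set.Ioo (0 : ℝ) 1)
    (hvar : ∀ k : ℕ, ∀ x ∈ SigmaSFT Λ, ∀ y ∈ SigmaSFT Λ,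
      (∀ j : ℤ, |j| ≤ (k : ℤ) → x j = y j) → |φ x - φ y| ≤ b * α ^ k)
    {μ : Measure (ℤ → Fin N)} {c₁ c₂ p : ℝ} (hGibbs : IsGibbs Λ φ μ c₁ c₂ p) (M : ℕ) :
    ∃ C : NNReal, ∀ k : ℕ, ∀ x ∈ SigmaSFT Λ, ∀ y ∈ SigmaSFT Λ,
      (∀ j : ℤ, (M : ℤ) ≤ |j| → x j = y j) →
      μ (windowCyl x (M + k) ∩ SigmaSFT Λ) ≤ C * μ (windowCyl y (M + k) ∩ SigmaSFT Λ) := by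
  obtain ⟨hprob, -, hinv, hc₁, hc₂, hcyl⟩ := hGibbs
  obtain ⟨D, hD⟩ := exists_birkhoff_sum_bound hsymb hdep hb hα hvar M
  refine ⟨(c₂ / c₁ * Real.exp D).toNNReal, fun k x hx y hy hxy => ?_⟩
  rw [measure_windowCyl_inter_SigmaSFT hinv, measure_windowCyl_inter_SigmaSFT hinv,
    ← ENNReal.toReal_le_toReal (measure_ne_top _ _)
      (ENNReal.mul_ne_top ENNReal.coe_ne_top (measure_ne_top _ _)),
    ENNReal.toReal_mul, ENNReal.coe_toReal, Real.coe_toNNReal _ (by positivity)]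
  have h1 := (hcyl _ (translate_mem_SigmaSFT hx (-((M + k : ℕ) : ℤ))) (2 * (M + k))).2
  have h2 := (hcyl _ (translate_mem_SigmaSFT hy (-((M + k : ℕ) : ℤ))) (2 * (M + k))).1
  set P : ℝ := -(p * (2 * (M + k) : ℕ))
  set X := ∑ j ∈ Finset.range (2 * (M + k)), φ (fun i => x (i + j + -((M + k : ℕ) : ℤ)))
  set Y := ∑ j ∈ Finset.range (2 * (M + k)), φ (fun i => y (i + j + -((M + k : ℕ) : ℤ)))
  have hXY : X ≤ Y + D := hD k x hx y hy hxy
  calc _ ≤ c₂ * Real.exp (P + X) := h1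
    _ ≤ c₂ * Real.exp (D + (P + Y)) := by
        exact mul_le_mul_of_nonneg_left (Real.exp_le_exp.2 (by linarith)) hc₂.le
    _ = c₂ / c₁ * Real.exp D * (c₁ * Real.exp (P + Y)) := by
        rw [Real.exp_add D]
        field_simp
    _ ≤ c₂ / c₁ * Real.exp D *
          (μ (cylSFT Λ (fun i => y (i + -((M + k : ℕ) : ℤ))) (2 * (M + k)))).toReal := by
        gcongr

end Subshift


/-- for a Gibbs measure for a potential depending only on nonnegative
coordinates with exponentially decreasing variation, for every finitely supported
involution `σ` there are constants `0 < α' ≤ β' < ∞` with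
`α'·μ(E) ≤ μ(T_σ⁻¹ E) ≤ β'·μ(E)` for every measurable `E ⊆ Γ_σ`. -/
theorem gibbs_uniform_quasiInvariance_constants
    {N : ℕ} (Λ : Fin N → Fin N → Bool)
    (hsymb : ∀ j : Fin N, ∃ x ∈ SigmaSFT Λ, x 0 = j)
    (φ : (ℤ → Fin N) → ℝ)
    (hdep : ∀ x ∈ SigmaSFT Λ, ∀ y ∈ SigmaSFT Λ,
      (∀ j : ℤ, 0 ≤ j → x j = y j) → φ x = φ y)
    (b α : ℝ) (hb : 0 < b) (hα : α ∈ Set.Ioo (0 : ℝ) 1)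
    (hvar : ∀ k : ℕ, ∀ x ∈ SigmaSFT Λ, ∀ y ∈ SigmaSFT Λ,
      (∀ j : ℤ, |j| ≤ (k : ℤ) → x j = y j) → |φ x - φ y| ≤ b * α ^ k)
    (μ : Measure (ℤ → Fin N)) (c₁ c₂ p : ℝ) (hGibbs : IsGibbs Λ φ μ c₁ c₂ p)
    (σ : Equiv.Perm ℤ) (hσ : FinitelySupported σ) (hσinv : ∀ n, σ (σ n) = n) :
    ∃ a b' : ℝ≥0∞, 0 < a ∧ a ≤ b' ∧ b' < ⊤ ∧
      ∀ E : Set (ℤ → Fin N), MeasurableSet E →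
        E ⊆ SigmaSFT Λ ∩ Tmap ⇑σ ⁻¹' SigmaSFT Λ →
        a * μ E ≤ μ (Tmap ⇑σ ⁻¹' E) ∧ μ (Tmap ⇑σ ⁻¹' E) ≤ b' * μ E := by
  obtain ⟨M, hM⟩ := hσ
  obtain ⟨C, hC⟩ := exists_windowCyl_comparison hsymb hdep hb hα hvar hGibbs M
  have : IsProbabilityMeasure μ := hGibbs.1
  set T : (ℤ → Fin N) → (ℤ → Fin N) := Tmap ⇑σ
  set Γ : Set (ℤ → Fin N) := SigmaSFT Λ ∩ T ⁻¹' SigmaSFT Λ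
  have hT : Measurable T := measurable_Tmap ⇑σ
  have hTT : ∀ x, T (T x) = x := Tmap_Tmap hσinv
  have hΓT : T ⁻¹' Γ = Γ := by
    ext x
    simp [Γ, hTT, and_comm]
  have hdom : (μ.restrict Γ).map T ≤ C • μ := by
    refine measure_le_of_windowCyl_le M fun k w => ?_
    have hw := measurableSet_windowCyl w (M + k)
    rw [Measure.map_apply hT hw, Measure.restrict_apply (hT hw), Measure.smul_apply]
    rcases (T ⁻¹' windowCyl w (M + k) ∩ Γ).eq_empty_or_nonempty with he | ⟨x, hxw, hx, hTx⟩
    · simp [he]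
    calc μ (T ⁻¹' windowCyl w (M + k) ∩ Γ) ≤ μ (windowCyl x (M + k) ∩ SigmaSFT Λ) :=
          measure_mono fun y hy =>
            ⟨mem_windowCyl_of_Tmap hM hσinv (Nat.le_add_right M k) hxw hy.1, hy.2.1⟩
      _ ≤ C * μ (windowCyl (T x) (M + k) ∩ SigmaSFT Λ) :=
          hC k x hx _ hTx fun j hj => (Tmap_apply_of_le_abs hM x hj).symm
      _ ≤ C * μ (windowCyl w (M + k)) := by
          gcongr
          exact fun y hy j hj => (hy.1 j hj).trans (hxw j hj)
  have hupper : ∀ E : Set (ℤ → Fin N), MeasurableSet E → E ⊆ Γ → μ (T ⁻¹' E) ≤ C * μ E := by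
    intro E hE hEΓ
    have h := hdom E
    rw [Measure.map_apply hT hE, Measure.restrict_apply (hT hE), Measure.smul_apply,
      Set.inter_eq_left.2 ((Set.preimage_mono hEΓ).trans hΓT.subset)] at h
    exact h
  set A : NNReal := max C 1
  have hA : (1 : NNReal) ≤ A := le_max_right _ _
  have hA0 : (A : ℝ≥0∞) ≠ 0 := by
    simpa using (zero_lt_one.trans_le hA).ne'
  have hA1 : (1 : ℝ≥0∞) ≤ A := by exact_mod_cast hA
  have hCA : (C : ℝ≥0∞) ≤ A := by exact_mod_cast le_max_left C 1
  refine ⟨(A : ℝ≥0∞)⁻¹, A, ENNReal.inv_pos.2 ENNReal.coe_ne_top,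
    (ENNReal.inv_le_one.2 hA1).trans hA1, ENNReal.coe_lt_top, fun E hE hEΓ => ⟨?_, ?_⟩⟩
  · have h := hupper (T ⁻¹' E) (hT hE) ((Set.preimage_mono hEΓ).trans hΓT.subset)
    have hpre : T ⁻¹' (T ⁻¹' E) = E := by
      ext x
      simp [hTT]
    rw [hpre] at h
    rw [ENNReal.inv_mul_le_iff hA0 ENNReal.coe_ne_top]
    exact h.trans (by gcongr)
  · exact (hupper E hE hEΓ).trans (by gcongr)
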